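/- Let (p_i)_{i≥0} be nonnegative reals with ∑_{i≥0} p_i = 1, p_0 ∈ (0,1), p_1 > 0, and mean ∑_{i≥0} i·p_i = 1, and let f(s) = ∑_{i≥0} p_i s^i. Define the sequence (ℓ_i)_{i≥0} by ℓ_0 = p_0, ℓ_1 = 1 − f(1−p_0), and ℓ_{i+1} = f(1 − ∑_{j=0}^{i−1} ℓ_j) − f(1 − ∑_{j=0}^{i} ℓ_j) for i ≥ 1. Then ℓ_i > 0 for all i and ℓ_i^{1/i} → p_1 as i → ∞. -/

import Mathlib

open Filter

/-- The ratio test controls the root test: if the ratios of consecutive terms of a positive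
sequence converge to `c > 0`, then so do the `n`-th roots. -/
theorem tendsto_rpow_one_div_of_tendsto_ratio {u : ℕ → ℝ} {c : ℝ} (hu : ∀ n, 0 < u n)
    (hc : 0 < c) (h : Tendsto (fun n => u (n + 1) / u n) atTop (nhds c)) :
    Tendsto (fun n : ℕ => u n ^ (1 / (n : ℝ))) atTop (nhds c) := by
  have hlog : Tendsto (fun n => Real.log (u (n + 1)) - Real.log (u n)) atTop
      (nhds (Real.log c)) :=
    (h.log hc.ne').congr fun n => Real.log_div (hu _).ne' (hu _).ne'
  have hces := hlog.cesaro
  simp only [Finset.sum_range_sub (fun n => Real.log (u n))] at hces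
  have h0 : Tendsto (fun n : ℕ => (n : ℝ)⁻¹ * Real.log (u 0)) atTop (nhds 0) := by
    simpa using (tendsto_inv_atTop_nhds_zero_nat (𝕜 := ℝ)).mul_const (Real.log (u 0))
  have hexp := (Real.continuous_exp.tendsto _).comp (hces.add h0)
  rw [add_zero, Real.exp_log hc] at hexp
  refine hexp.congr fun n => ?_
  rw [Real.rpow_def_of_pos (hu n), Function.comp_apply]
  congr 1
  ring

theorem summable_mul_pow_of_mem_Icc {p : ℕ → ℝ} (hp : ∀ i, 0 ≤ p i) (hsum : Summable p)
    {s : ℝ} (hs : s ∈ Set.Icc (0 : ℝ) 1) : Summable (fun i => p i * s ^ i) :=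
  hsum.of_nonneg_of_le (fun i => mul_nonneg (hp i) (pow_nonneg hs.1 i))
    fun i => mul_le_of_le_one_right (hp i) (pow_le_one₀ hs.1 hs.2)

/-- The tail of a power series with nonnegative summable coefficients is at most `s ^ k` times
the tail of the coefficient sum. -/
theorem tsum_mul_pow_add_le {p : ℕ → ℝ} (hp : ∀ i, 0 ≤ p i) (hsum : Summable p)
    {s : ℝ} (hs : s ∈ Set.Icc (0 : ℝ) 1) (k : ℕ) :
    ∑' i, p (i + k) * s ^ (i + k) ≤ s ^ k * ∑' i, p (i + k) := by
  rw [← tsum_mul_left]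
  refine Summable.tsum_le_tsum (fun i => ?_)
    ((summable_nat_add_iff k).2 (summable_mul_pow_of_mem_Icc hp hsum hs))
    (((summable_nat_add_iff k).2 hsum).mul_left _)
  rw [mul_comm (s ^ k)]
  exact mul_le_mul_of_nonneg_left (pow_le_pow_of_le_one hs.1 hs.2 (Nat.le_add_left k i)) (hp _)

/-- For a critical offspring distribution with `p 0 ∈ (0,1)` and
`p 1 > 0`, the leaf-height distribution `(ℓ i)` of the root satisfies `ℓ i > 0`
and `ℓ i = (p 1 + o(1))^i`, i.e. `(ℓ i)^{1/i} → p 1`. -/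
theorem leaf_height_distribution_asymptotics_p1_pos
    (p : ℕ → ℝ) (hp : ∀ i, 0 ≤ p i) (hsum : ∑' i, p i = 1)
    (hp0 : p 0 ∈ Set.Ioo (0 : ℝ) 1) (hp1 : 0 < p 1)
    (hmean_summable : Summable (fun i : ℕ => (i : ℝ) * p i))
    (hmean : ∑' i : ℕ, (i : ℝ) * p i = 1)
    (f : ℝ → ℝ) (hf : ∀ s ∈ Set.Icc (0 : ℝ) 1, f s = ∑' i, p i * s ^ i)
    (ℓ : ℕ → ℝ)
    (hl0 : ℓ 0 = p 0)
    (hl1 : ℓ 1 = 1 - f (1 - p 0))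
    (hlrec : ∀ i : ℕ, 1 ≤ i →
      ℓ (i + 1) = f (1 - ∑ j ∈ Finset.range i, ℓ j) -
        f (1 - ∑ j ∈ Finset.range (i + 1), ℓ j)) :
    (∀ i, 0 < ℓ i) ∧
      Tendsto (fun i : ℕ => ℓ i ^ (1 / (i : ℝ))) atTop (nhds (p 1)) := by
  have hs : Summable p := by
    by_contra h
    rw [tsum_eq_zero_of_not_summable h] at hsum
    exact zero_ne_one hsum
  obtain ⟨hp0_pos, -⟩ := hp0
  have htail : ∀ k, ∑ i ∈ Finset.range k, p i + ∑' i, p (i + k) = 1 := fun k => by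
    rw [hs.sum_add_tsum_nat_add k, hsum]
  have hsplit : ∀ s ∈ Set.Icc (0 : ℝ) 1, ∀ k,
      f s = ∑ i ∈ Finset.range k, p i * s ^ i + ∑' i, p (i + k) * s ^ (i + k) := fun s hs' k => by
    rw [hf s hs', (summable_mul_pow_of_mem_Icc hp hs hs').sum_add_tsum_nat_add k]
  have hlower : ∀ s ∈ Set.Icc (0 : ℝ) 1, p 1 * s ≤ f s - p 0 := fun s hs' => by
    have h := hsplit s hs' 2
    have h' : 0 ≤ ∑' i, p (i + 2) * s ^ (i + 2) :=
      tsum_nonneg fun i => mul_nonneg (hp _) (pow_nonneg hs'.1 _)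
    simp only [Finset.sum_range_succ, Finset.sum_range_zero, pow_zero, pow_one] at h
    linarith
  have hupper : ∀ s ∈ Set.Icc (0 : ℝ) 1, f s - p 0 ≤ (1 - p 0) * s := fun s hs' => by
    have h := hsplit s hs' 1
    have h' := tsum_mul_pow_add_le hp hs hs' 1
    have ht := htail 1
    simp only [Finset.sum_range_one, pow_zero, pow_one] at h h' ht
    rw [eq_sub_of_add_eq' ht] at h'
    linarith
  have hupper_sq : ∀ s ∈ Set.Icc (0 : ℝ) 1, f s - p 0 ≤ p 1 * s + s ^ 2 := fun s hs' => by
    have h := hsplit s hs' 2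
    have h' := tsum_mul_pow_add_le hp hs hs' 2
    have ht := htail 2
    simp only [Finset.sum_range_succ, Finset.sum_range_zero, pow_zero, pow_one] at h ht
    have ht' : ∑' i, p (i + 2) ≤ 1 := by linarith
    have := mul_le_of_le_one_right (sq_nonneg s) ht'
    linarith
  have hp01 : p 0 + p 1 ≤ 1 := by
    have := (hlower 1 (by simp)).trans (hupper 1 (by simp))
    linarith
  have hf1 : f 1 = 1 := by simpa [hsum] using hf 1 (by simp)
  -- The probability that the leaf-height is at least `n`.
  set S : ℕ → ℝ := fun n => 1 - ∑ j ∈ Finset.range n, ℓ j with hS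
  have hS0 : S 0 = 1 := by simp [hS]
  have hℓS : ∀ n, ℓ n = S n - S (n + 1) := fun n => by
    simp only [hS, Finset.sum_range_succ]
    ring
  have hℓf : ∀ n, ℓ (n + 1) = f (S n) - f (S (n + 1)) := fun n => by
    rcases Nat.eq_zero_or_pos n with rfl | hn
    · rw [hS0, hf1, hl1]
      simp [hS, hl0]
    · exact hlrec n hn
  have hSrec : ∀ n, S (n + 1) = f (S n) - p 0 := fun n => by
    induction n with
    | zero => rw [hS0, hf1]; simp [hS, hl0]
    | succ n ih =>
      have h1 := hℓf n
      have h2 := hℓS (n + 1)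
      linarith
  have hSmem : ∀ n, 0 < S n ∧ S n ≤ (1 - p 0) ^ n := fun n => by
    induction n with
    | zero => simp [hS0]
    | succ n ih =>
      have hmem : S n ∈ Set.Icc (0 : ℝ) 1 :=
        ⟨ih.1.le, ih.2.trans (pow_le_one₀ (by linarith) (by linarith))⟩
      rw [hSrec n]
      refine ⟨(mul_pos hp1 ih.1).trans_le (hlower _ hmem), (hupper _ hmem).trans ?_⟩
      rw [pow_succ']
      exact mul_le_mul_of_nonneg_left ih.2 (by linarith)
  have hSpos : ∀ n, 0 < S n := fun n => (hSmem n).1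
  have hSIcc : ∀ n, S n ∈ Set.Icc (0 : ℝ) 1 := fun n =>
    ⟨(hSpos n).le, (hSmem n).2.trans (pow_le_one₀ (by linarith) (by linarith))⟩
  have hSlim : Tendsto S atTop (nhds 0) :=
    squeeze_zero (fun n => (hSpos n).le) (fun n => (hSmem n).2)
      (tendsto_pow_atTop_nhds_zero_of_lt_one (by linarith) (by linarith))
  have hratio : Tendsto (fun n => S (n + 1) / S n) atTop (nhds (p 1)) := by
    refine tendsto_of_tendsto_of_tendsto_of_le_of_le tendsto_const_nhds
      (by simpa using hSlim.const_add (p 1)) (fun n => ?_) (fun n => ?_)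
    · rw [le_div_iff₀ (hSpos n), hSrec]
      exact hlower _ (hSIcc n)
    · rw [div_le_iff₀ (hSpos n), hSrec]
      linarith [hupper_sq _ (hSIcc n)]
  have hℓpos : ∀ n, 0 < ℓ n := fun n => by
    have h := hupper _ (hSIcc n)
    have h' := mul_pos hp0_pos (hSpos n)
    rw [hℓS, hSrec]
    linarith
  refine ⟨hℓpos, tendsto_rpow_one_div_of_tendsto_ratio hℓpos hp1 ?_⟩
  have hcomp : Tendsto (fun n => ℓ n / S n) atTop (nhds (1 - p 1)) :=
    (hratio.const_sub 1).congr fun n => by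
      rw [hℓS, sub_div (S n), div_self (hSpos n).ne']
  have hne : 1 - p 1 ≠ 0 := by
    refine ne_of_gt ?_
    linarith
  have hlim := (((tendsto_add_atTop_iff_nat 1).2 hcomp).div hcomp hne).mul hratio
  rw [div_self hne, one_mul] at hlim
  refine hlim.congr fun n => ?_
  have h1 := (hSpos n).ne'
  have h2 := (hSpos (n + 1)).ne'
  have h3 := (hℓpos n).ne'
  simp only [Pi.div_apply]
  field_simp
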